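/- Let (I, (A_i), (u_i)) be an ordinal potential game with ordinal potential φ. Then every strategy profile that maximizes φ over ∏_{j∈I} A_j is a pure Nash equilibrium. Consequently, if each A_i is a nonempty compact topological space and φ is continuous on ∏_{j∈I} A_j (with the product topology), the game possesses at least one pure Nash equilibrium. -/

import Mathlib

/-- Every maximizer of an ordinal potential is a pure Nash equilibrium. No topology on the strategy
sets and no continuity of the potential is needed. -/
theorem ordinal_potential_maximizer_is_nash {ι : Type*} [DecidableEq ι] {A : ι → Type*}
    (u : ι → (∀ j, A j) → ℝ) (φ : (∀ j, A j) → ℝ)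
    (hφ : ∀ (i : ι) (a : ∀ j, A j) (b b' : A i),
      u i (Function.update a i b) > u i (Function.update a i b') ↔
        φ (Function.update a i b) > φ (Function.update a i b'))
    (a : ∀ j, A j) (ha : ∀ b : ∀ j, A j, φ b ≤ φ a) (i : ι) (b : A i) :
    u i (Function.update a i b) ≤ u i a := by
  have h := hφ i a b (a i)
  rw [Function.update_eq_self] at h
  exact not_lt.mp fun hlt => (ha _).not_gt (h.mp hlt)

/-- In an ordinal potential game, every maximizer of the ordinal potential `φ`
is a pure Nash equilibrium; consequently, if each strategy set is a nonempty
compact topological space and `φ` is continuous on the product space, the game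
possesses at least one pure Nash equilibrium. -/
theorem ordinal_potential_maximizer_is_nash_and_compact_existence
    {ι : Type*} [Fintype ι] [DecidableEq ι]
    {A : ι → Type*} [∀ i, TopologicalSpace (A i)] [∀ i, CompactSpace (A i)]
    [∀ i, Nonempty (A i)]
    (u : ι → (∀ j, A j) → ℝ) (φ : (∀ j, A j) → ℝ)
    (hφ : ∀ (i : ι) (a : ∀ j, A j) (b b' : A i),
      u i (Function.update a i b) > u i (Function.update a i b') ↔
        φ (Function.update a i b) > φ (Function.update a i b'))
    (hcont : Continuous φ) :
    (∀ a : ∀ j, A j, (∀ b : ∀ j, A j, φ b ≤ φ a) →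
        ∀ (i : ι) (b : A i), u i (Function.update a i b) ≤ u i a) ∧
      ∃ a : ∀ j, A j, ∀ (i : ι) (b : A i), u i (Function.update a i b) ≤ u i a := by
  have hnash := ordinal_potential_maximizer_is_nash u φ hφ
  refine ⟨hnash, ?_⟩
  obtain ⟨a, -, ha⟩ := isCompact_univ.exists_isMaxOn Set.univ_nonempty hcont.continuousOn
  exact ⟨a, hnash a fun b => ha (Set.mem_univ b)⟩
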